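/- Let R be a Noetherian domain over a field K of characteristic 0 with a locally nilpotent derivation d and an element x ∈ R with d(x) = 1, and set S = R[θ; d]. For any a ∈ R \ R^d and I = S(θ + a)θ, the submodule Sθ/I is an essential left S-submodule of S/I; consequently, if S/S(θ + a) is Artinian, then S/I is a finitely generated essential extension of the Artinian module S/S(θ+a) ≅ Sθ/I. -/

import Mathlib

/-- `S = R[θ; d]` : `S` is free as a left `R`-module with basis `{θ^n}` (equivalently,
the evaluation map from polynomials is bijective) and `θ a = a θ + d(a)`. -/
structure IsDiffOpRing {R S : Type*} [Ring R] [Ring S] (d : R → R) (ι : R →+* S)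
    (θ : S) : Prop where
  basis : Function.Bijective fun p : Polynomial R => p.sum fun i a => ι a * θ ^ i
  rel : ∀ a : R, θ * ι a = ι a * θ + ι (d a)

open Polynomial in
theorem IsDiffOpRing.eval₂_bijective {R S : Type*} [Ring R] [Ring S] {d : R → R} {ι : R →+* S}
    {θ : S} (hS : IsDiffOpRing d ι θ) : Function.Bijective (eval₂ ι θ) := by
  have h : (eval₂ ι θ) = fun p : R[X] => p.sum fun i a => ι a * θ ^ i := by
    funext p
    exact eval₂_eq_sum
  rw [h]
  exact hS.basis

open Polynomial in
theorem IsDiffOpRing.mul_theta_injective {R S : Type*} [Ring R] [Ring S] {d : R → R} {ι : R →+* S}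
    {θ : S} (hS : IsDiffOpRing d ι θ) {u v : S} (h : u * θ = v * θ) : u = v := by
  obtain ⟨p, rfl⟩ := hS.eval₂_bijective.2 u
  obtain ⟨q, rfl⟩ := hS.eval₂_bijective.2 v
  rw [← eval₂_mul_X, ← eval₂_mul_X] at h
  have h' := hS.eval₂_bijective.1 h
  congr 1
  ext n
  simpa using congrArg (fun r : R[X] => r.coeff (n + 1)) h'

open Polynomial in
theorem IsDiffOpRing.exists_eq_add_mul_theta {R S : Type*} [Ring R] [Ring S] {d : R → R}
    {ι : R →+* S} {θ : S} (hS : IsDiffOpRing d ι θ) (s : S) : ∃ r g, s = ι r + g * θ := by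
  obtain ⟨p, rfl⟩ := hS.eval₂_bijective.2 s
  refine ⟨p.coeff 0, eval₂ ι θ p.divX, ?_⟩
  conv_lhs => rw [← divX_mul_X_add p]
  rw [eval₂_add, eval₂_mul_X, eval₂_C, add_comm]

theorem IsDiffOpRing.exists_eq_add_mul_theta_add {R S : Type*} [Ring R] [Ring S] {d : R → R}
    {ι : R →+* S} {θ : S} (hS : IsDiffOpRing d ι θ) (a : R) (s : S) :
    ∃ b h, s = ι b + h * (θ + ι a) := by
  obtain ⟨p, rfl⟩ := hS.eval₂_bijective.2 s
  have key : ∀ n : ℕ, ∃ b h, θ ^ n = ι b + h * (θ + ι a) := by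
    intro n
    induction n with
    | zero => exact ⟨1, 0, by simp⟩
    | succ n ih =>
      obtain ⟨b, h, e⟩ := ih
      refine ⟨d b - b * a, θ * h + ι b, ?_⟩
      rw [pow_succ', e, mul_add, hS.rel]
      simp only [map_sub, map_mul]
      noncomm_ring
  induction p using Polynomial.induction_on' with
  | add p q hp hq =>
    obtain ⟨b, h, e⟩ := hp
    obtain ⟨b', h', e'⟩ := hq
    refine ⟨b + b', h + h', ?_⟩
    rw [Polynomial.eval₂_add, e, e', map_add]
    noncomm_ring
  | monomial n r =>
    obtain ⟨b, h, e⟩ := key n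
    refine ⟨r * b, ι r * h, ?_⟩
    rw [Polynomial.eval₂_monomial, e, map_mul]
    noncomm_ring

open Polynomial in
theorem IsDiffOpRing.theta_pow_mul {R S : Type*} [Ring R] [Ring S] {d : R → R}
    {ι : R →+* S} {θ : S} (hS : IsDiffOpRing d ι θ) (n : ℕ) (a : R) :
    ∃ q : R[X], q.natDegree ≤ n ∧ θ ^ n * ι a = eval₂ ι θ q := by
  induction n generalizing a with
  | zero => exact ⟨C a, by simp⟩
  | succ n ih =>
    obtain ⟨q, hq, e⟩ := ih a
    obtain ⟨q', hq', e'⟩ := ih (d a)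
    refine ⟨q * X + q', ?_, ?_⟩
    · refine natDegree_add_le_of_degree_le ?_ (by omega)
      exact natDegree_mul_le.trans (add_le_add hq natDegree_X_le)
    · rw [eval₂_add, eval₂_mul_X, ← e, ← e', pow_succ, mul_assoc, hS.rel]
      noncomm_ring

open Polynomial in
theorem IsDiffOpRing.eval₂_mul {R S : Type*} [Ring R] [Ring S] {d : R → R}
    {ι : R →+* S} {θ : S} (hS : IsDiffOpRing d ι θ) (p : R[X]) (a : R) :
    ∃ q : R[X], q.natDegree ≤ p.natDegree ∧ eval₂ ι θ p * ι a = eval₂ ι θ q := by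
  choose q hq e using fun n => hS.theta_pow_mul n a
  refine ⟨∑ i ∈ p.support, C (p.coeff i) * q i, ?_, ?_⟩
  · refine natDegree_sum_le_of_forall_le _ _ fun i hi => ?_
    exact (natDegree_C_mul_le _ _).trans ((hq i).trans (le_natDegree_of_mem_supp i hi))
  · rw [eval₂_finsetSum, eval₂_eq_sum, Polynomial.sum, Finset.sum_mul]
    refine Finset.sum_congr rfl fun i _ => ?_
    rw [mul_assoc, e, C_mul', eval₂_smul]

open Polynomial in
theorem IsDiffOpRing.eq_zero_of_eq_mul_theta_add {R S : Type*} [Ring R] [Ring S] {d : R → R}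
    {ι : R →+* S} {θ : S} (hS : IsDiffOpRing d ι θ) {a t : R} {h : S}
    (ht : ι t = h * (θ + ι a)) : t = 0 := by
  obtain ⟨p, rfl⟩ := hS.eval₂_bijective.2 h
  obtain ⟨q, hq, e⟩ := hS.eval₂_mul p a
  rw [mul_add, e, ← eval₂_mul_X, ← eval₂_add, ← eval₂_C ι θ] at ht
  have h' := hS.eval₂_bijective.1 ht
  have hp : p = 0 := by
    have := congrArg (fun r : R[X] => r.coeff (p.natDegree + 1)) h'
    simp only [coeff_C_succ, coeff_add, coeff_mul_X,
      coeff_eq_zero_of_natDegree_lt (Nat.lt_succ_of_le hq), add_zero] at this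
    exact leadingCoeff_eq_zero.1 this.symm
  subst hp
  have hq0 : eval₂ ι θ q = eval₂ ι θ 0 := by rw [← e]; simp
  rw [hS.eval₂_bijective.1 hq0] at h'
  simpa using h'

theorem exists_iterate_ne_zero_and_succ_eq_zero {R : Type*} [Zero R] {d : R → R} {r : R}
    (hr : r ≠ 0) (h : ∃ n : ℕ, 0 < n ∧ d^[n] r = 0) :
    ∃ n : ℕ, d^[n] r ≠ 0 ∧ d^[n + 1] r = 0 := by
  classical
  have h' : ∃ n : ℕ, d^[n] r = 0 := h.imp fun _ hn => hn.2
  obtain ⟨k, hk⟩ : ∃ k, Nat.find h' = k + 1 :=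
    Nat.exists_eq_succ_of_ne_zero fun h0 => hr (by simpa [h0] using Nat.find_spec h')
  exact ⟨k, Nat.find_min h' (by omega), hk ▸ Nat.find_spec h'⟩

/-- The top term in the general Leibniz rule. -/
theorem iterate_add_mul_of_iterate_succ_eq_zero {R : Type*} [Ring R] (d : R →+ R)
    (hmul : ∀ a b : R, d (a * b) = d a * b + a * d b) (m n : ℕ) :
    ∀ b a : R, d^[m + 1] b = 0 → d^[n + 1] a = 0 →
      d^[m + n] (b * a) = ((m + n).choose m : R) * (d^[m] b * d^[n] a) := by
  induction m generalizing n with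
  | zero =>
    intro b a hb _
    have hb' : d b = 0 := by simpa using hb
    have key : ∀ k, d^[k] (b * a) = b * d^[k] a := by
      intro k
      induction k with
      | zero => rfl
      | succ k ih => simp only [Function.iterate_succ_apply', ih, hmul, hb', zero_mul, zero_add]
    simp [key]
  | succ m ihm =>
    induction n with
    | zero =>
      intro b a _ ha
      have ha' : d a = 0 := by simpa using ha
      have key : ∀ k, d^[k] (b * a) = d^[k] b * a := by
        intro k
        induction k with
        | zero => rfl
        | succ k ih => simp only [Function.iterate_succ_apply', ih, hmul, ha', mul_zero, add_zero]
      simp only [add_zero, key, Nat.choose_self, Nat.cast_one, one_mul, Function.iterate_zero, id]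
    | succ n ihn =>
      intro b a hb ha
      have h1 := ihm (n + 1) (d b) a hb ha
      have h2 := ihn b (d a) hb ha
      rw [show m + 1 + (n + 1) = (m + 1 + n) + 1 by ring, Function.iterate_succ_apply, hmul,
        iterate_map_add, h2, show m + 1 + n = m + (n + 1) by ring, h1, Nat.choose_succ_succ,
        Nat.cast_add, add_mul]
      simp only [Function.iterate_succ_apply]

theorem derivation_ne_mul_sub_const {R : Type*} [Ring R] [IsDomain R] [CharZero R] (d : R →+ R)
    (hmul : ∀ a b : R, d (a * b) = d a * b + a * d b)
    (hln : ∀ a : R, ∃ n : ℕ, 0 < n ∧ d^[n] a = 0) {a b c : R} (ha : d a ≠ 0)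
    (hc : c ≠ 0) (hdc : d c = 0) : c + d b - b * a ≠ 0 := by
  intro h
  have hb : b ≠ 0 := by
    rintro rfl
    exact hc (by simpa using h)
  obtain ⟨m, hm, hm'⟩ := exists_iterate_ne_zero_and_succ_eq_zero hb (hln b)
  obtain ⟨n, hn, hn'⟩ := exists_iterate_ne_zero_and_succ_eq_zero ha (hln (d a))
  have key := iterate_add_mul_of_iterate_succ_eq_zero d hmul m (n + 1) b a hm' hn'
  have hz : ∀ k, d^[k] (0 : R) = 0 := fun k => iterate_map_zero d k
  have h1 : d^[m + (n + 1)] (d b) = 0 := by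
    rw [← Function.iterate_succ_apply, show (m + (n + 1)).succ = (n + 1) + (m + 1) by omega,
      Function.iterate_add_apply, hm', hz]
  have h2 : d^[m + (n + 1)] c = 0 := by
    rw [← add_assoc, Function.iterate_succ_apply, hdc, hz]
  rw [← sub_eq_zero.1 h, iterate_map_add, h1, h2, add_zero] at key
  have hch : ((m + (n + 1)).choose m : R) ≠ 0 :=
    Nat.cast_ne_zero.2 (Nat.choose_pos (by omega)).ne'
  exact mul_ne_zero hch (mul_ne_zero hm hn) key.symm

/-- For a Noetherian domain `R` over a field of characteristic `0` with locally nilpotent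
derivation `d`, `x ∈ R` with `d x = 1`, `S = R[θ; d]`, `a ∈ R \ R^d` and `I = S(θ+a)θ`,
the submodule `Sθ/I` is essential in `S/I`; moreover `S/I` is finitely generated and
`S/S(θ+a) ≅ Sθ/I`, so if `S/S(θ+a)` is Artinian then `S/I` is a finitely generated
essential extension of the Artinian module `Sθ/I`. -/
theorem essential_extension_over_theta
    (K : Type*) [Field K] [CharZero K]
    (R : Type*) [Ring R] [IsDomain R] [IsNoetherianRing R] [Algebra K R]
    (d : R → R)
    (hadd : ∀ a b : R, d (a + b) = d a + d b)
    (hmul : ∀ a b : R, d (a * b) = d a * b + a * d b)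
    (hln : ∀ a : R, ∃ n : ℕ, 0 < n ∧ d^[n] a = 0)
    (x : R) (hx : d x = 1)
    (S : Type*) [Ring S] (ι : R →+* S) (θ : S) (hS : IsDiffOpRing d ι θ)
    (a : R) (ha : d a ≠ 0) :
    ∀ I : Submodule S S, I = Submodule.span S {(θ + ι a) * θ} →
      ∀ N : Submodule S (S ⧸ I), N = (Submodule.span S {θ}).map I.mkQ →
        (∀ N' : Submodule S (S ⧸ I), N ⊓ N' = ⊥ → N' = ⊥) ∧
        Module.Finite S (S ⧸ I) ∧
        Nonempty ((S ⧸ (Submodule.span S {θ + ι a} : Submodule S S)) ≃ₗ[S] ↥N) ∧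
        (IsArtinian S (S ⧸ (Submodule.span S {θ + ι a} : Submodule S S)) →
          IsArtinian S ↥N) := by
  rintro I rfl N rfl
  have : CharZero R := charZero_of_injective_algebraMap (algebraMap K R).injective
  obtain ⟨D, rfl⟩ : ∃ D : R →+ R, d = D := ⟨AddMonoidHom.mk' d hadd, rfl⟩
  have hmem : ∀ s : S, s * θ ∈ Submodule.span S {(θ + ι a) * θ} ↔
      s ∈ Submodule.span S {θ + ι a} := by
    intro s
    simp only [Submodule.mem_span_singleton, smul_eq_mul, ← mul_assoc]
    exact exists_congr fun k => ⟨hS.mul_theta_injective, fun h => by rw [h]⟩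
  have e : (S ⧸ (Submodule.span S {θ + ι a} : Submodule S S)) ≃ₗ[S]
      ↥((Submodule.span S {θ}).map (Submodule.span S {(θ + ι a) * θ}).mkQ) := by
    let φ := (Submodule.span S {(θ + ι a) * θ}).mkQ ∘ₗ LinearMap.toSpanSingleton S S θ
    have hker : Submodule.span S {θ + ι a} = LinearMap.ker φ := by
      ext s
      simp [φ, ← hmem s]
    have hrange : LinearMap.range φ =
        (Submodule.span S {θ}).map (Submodule.span S {(θ + ι a) * θ}).mkQ := by
      rw [LinearMap.range_comp, LinearMap.range_toSpanSingleton]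
    exact (Submodule.quotEquivOfEq _ _ hker).trans
      (φ.quotKerEquivRange.trans (LinearEquiv.ofEq _ _ hrange))
  refine ⟨fun N' hN => ?_, inferInstance, ⟨e⟩, fun _ => isArtinian_of_linearEquiv e⟩
  have hdisj : ∀ g : S, Submodule.Quotient.mk (g * θ) ∈ N' →
      g ∈ Submodule.span S {θ + ι a} := by
    intro g hg
    rw [← hmem, ← Submodule.Quotient.mk_eq_zero, ← Submodule.mem_bot S, ← hN]
    exact ⟨⟨g * θ, Submodule.mem_span_singleton.2 ⟨g, rfl⟩, rfl⟩, hg⟩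
  rw [Submodule.eq_bot_iff]
  intro u hu
  obtain ⟨f, rfl⟩ := Submodule.Quotient.mk_surjective _ u
  obtain ⟨r, g, rfl⟩ := hS.exists_eq_add_mul_theta f
  by_cases hr : r = 0
  · subst hr
    rw [map_zero, zero_add] at hu ⊢
    exact (Submodule.Quotient.mk_eq_zero _).2 ((hmem g).2 (hdisj g hu))
  exfalso
  obtain ⟨n, hn, hn'⟩ := exists_iterate_ne_zero_and_succ_eq_zero hr (hln r)
  have hpow : ∀ k, ∃ g', θ ^ k * (ι r + g * θ) = ι (D^[k] r) + g' * θ := by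
    intro k
    induction k with
    | zero => exact ⟨g, by simp⟩
    | succ k ih =>
      obtain ⟨g', e'⟩ := ih
      refine ⟨ι (D^[k] r) + θ * g', ?_⟩
      rw [pow_succ', mul_assoc, e', mul_add, hS.rel, Function.iterate_succ_apply']
      noncomm_ring
  obtain ⟨g', hg'⟩ := hpow n
  obtain ⟨b, h, rfl⟩ := hS.exists_eq_add_mul_theta_add a g'
  rw [Function.iterate_succ_apply'] at hn'
  set c := D^[n] r
  have hθ : θ * (θ ^ n * (ι r + g * θ)) =
      (ι (c + D b - b * a) + (θ * h + ι b) * (θ + ι a)) * θ := by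
    have h1 := hS.rel c
    rw [hn', map_zero, add_zero] at h1
    rw [hg', mul_add, h1, ← mul_assoc, mul_add, hS.rel b]
    simp only [map_sub, map_add, map_mul]
    noncomm_ring
  have hmemN : Submodule.Quotient.mk
      ((ι (c + D b - b * a) + (θ * h + ι b) * (θ + ι a)) * θ) ∈ N' := by
    rw [← hθ, ← mul_assoc]
    exact N'.smul_mem (θ * θ ^ n) hu
  obtain ⟨k, hk⟩ := Submodule.mem_span_singleton.1 (hdisj _ hmemN)
  refine derivation_ne_mul_sub_const D hmul hln (b := b) ha hn hn'
    (hS.eq_zero_of_eq_mul_theta_add (a := a) (h := k - (θ * h + ι b)) ?_)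
  rw [sub_mul, ← smul_eq_mul k, hk, add_sub_cancel_right]
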